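/- Let p,q∈(1,∞). The simple A_{p,q}-condition is sufficient for the two weight Stein inequality if and only if 1<p≤2≤q<∞; that is, the implication "(σ,w)_{p,q}<∞ ⟹ 𝒮(σ,w,p,q)<∞, for all Radon measures σ, w on ℝ^N" holds precisely when 1<p≤2≤q<∞. -/

import Mathlib

open MeasureTheory ENNReal Set

noncomputable section

abbrev EucN (N : ℕ) := Fin N → ℝ

/-- The half-open cube `x + [0, 2^{-k})^N`. -/
def dyCube (N : ℕ) (k : ℤ) (x : EucN N) : Set (EucN N) :=
  {y | ∀ i, x i ≤ y i ∧ y i < x i + (2 : ℝ) ^ (-k)}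

/-- A dyadic lattice on `ℝ^N`: for every `k ∈ ℤ`, `gen k` is a partition of `ℝ^N` into
half-open cubes of side `2^{-k}`, and the generations are nested. -/
structure DyadicLattice (N : ℕ) where
  gen : ℤ → Set (Set (EucN N))
  cube_form : ∀ k Q, Q ∈ gen k → ∃ x, Q = dyCube N k x
  covers : ∀ k (y : EucN N), ∃ Q ∈ gen k, y ∈ Q
  pairwiseDisjoint : ∀ k, (gen k).PairwiseDisjoint id
  nested : ∀ k, ∀ Q ∈ gen (k + 1), ∃ R ∈ gen k, Q ⊆ R

namespace DyadicLattice
variable {N : ℕ}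
/-- The collection `𝒟` of all dyadic cubes. -/
def cubes (D : DyadicLattice N) : Set (Set (EucN N)) := ⋃ k, D.gen k
/-- `Q'` is a dyadic child of `Q`. -/
def child (D : DyadicLattice N) (Q Q' : Set (EucN N)) : Prop :=
  ∃ k, Q ∈ D.gen k ∧ Q' ∈ D.gen (k + 1) ∧ Q' ⊆ Q
/-- `R = Q^{(r)}` is the `r`-th dyadic ancestor of `Q`. -/
def anc (D : DyadicLattice N) (r : ℕ) (Q R : Set (EucN N)) : Prop :=
  ∃ k : ℤ, Q ∈ D.gen k ∧ R ∈ D.gen (k - r) ∧ Q ⊆ R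
end DyadicLattice

/-- `ℝ≥0∞`-valued indicator of a set. -/
def indE {N : ℕ} (Q : Set (EucN N)) (x : EucN N) : ℝ≥0∞ := Q.indicator 1 x

/-- `‖ (∑ i (f i)²)^{1/2} ‖_{L^p(μ)}` for a family of `ℝ≥0∞`-valued functions. -/
def sqNorm {N : ℕ} {ι : Type*} (μ : Measure (EucN N)) (p : ℝ)
    (f : ι → EucN N → ℝ≥0∞) : ℝ≥0∞ :=
  (∫⁻ x, (∑' i, f i x ^ 2) ^ (p / 2) ∂μ) ^ (1 / p)

/-- The quadratic `𝒜_{p,q}` constant `[σ,w]_{p,q}`: the least `C` such that for all real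
coefficients `(a_Q)_{Q ∈ 𝒟}`,
`‖(∑_Q (a_Q σ(Q)/|Q|)² 1_Q)^{1/2}‖_{L^q(w)} ≤ C ‖(∑_Q a_Q² 1_Q)^{1/2}‖_{L^p(σ)}`. -/
def sqA {N : ℕ} (D : DyadicLattice N) (σ w : Measure (EucN N)) (p q : ℝ) : ℝ≥0∞ :=
  sInf {C | ∀ a : Set (EucN N) → ℝ,
    sqNorm w q (fun Q : D.cubes => fun x =>
      (‖a (Q : Set (EucN N))‖₊ : ℝ≥0∞) * σ (Q : Set (EucN N)) / volume (Q : Set (EucN N))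
        * indE (Q : Set (EucN N)) x)
    ≤ C * sqNorm σ p (fun Q : D.cubes => fun x =>
      (‖a (Q : Set (EucN N))‖₊ : ℝ≥0∞) * indE (Q : Set (EucN N)) x)}

/-- The simple (Muckenhoupt type) `A_{p,q}` constant
`(σ,w)_{p,q} = sup_{Q ∈ 𝒟} σ(Q)^{1/p'} w(Q)^{1/q} / |Q|`. -/
def simpleA {N : ℕ} (D : DyadicLattice N) (σ w : Measure (EucN N)) (p q : ℝ) : ℝ≥0∞ :=
  ⨆ Q ∈ D.cubes, σ Q ^ (1 - 1 / p) * w Q ^ (1 / q) / volume Q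

/-- The best constant `𝒮(σ,w,p,q)` in the two-weight Stein inequality: the least `C` such
that for every collection `(f_Q)_{Q ∈ 𝒟}` of locally `σ`-integrable functions,
`‖(∑_Q (∫_Q f_Q dσ / |Q|)² 1_Q)^{1/2}‖_{L^q(w)} ≤ C ‖(∑_Q f_Q² 1_Q)^{1/2}‖_{L^p(σ)}`. -/
def steinC {N : ℕ} (D : DyadicLattice N) (σ w : Measure (EucN N)) (p q : ℝ) : ℝ≥0∞ :=
  sInf {C | ∀ f : Set (EucN N) → EucN N → ℝ,
    (∀ Q ∈ D.cubes, LocallyIntegrable (f Q) σ) →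
    sqNorm w q (fun Q : D.cubes => fun x =>
      ENNReal.ofReal |∫ y in (Q : Set (EucN N)), f (Q : Set (EucN N)) y ∂σ|
        / volume (Q : Set (EucN N)) * indE (Q : Set (EucN N)) x)
    ≤ C * sqNorm σ p (fun Q : D.cubes => fun x =>
      (‖f (Q : Set (EucN N)) x‖₊ : ℝ≥0∞) * indE (Q : Set (EucN N)) x)}

theorem lintegral_tsum_rpow_le {α ι : Type*} [MeasurableSpace α] [Countable ι] {μ : Measure α}
    {r : ℝ} (hr : 1 ≤ r) {g : ι → α → ℝ≥0∞} (hg : ∀ i, AEMeasurable (g i) μ) :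
    (∫⁻ x, (∑' i, g i x) ^ r ∂μ) ^ (1 / r) ≤ ∑' i, (∫⁻ x, g i x ^ r ∂μ) ^ (1 / r) := by
  have hr0 : 0 < r := by linarith
  have hfin (s : Finset ι) :
      (∫⁻ x, (∑ i ∈ s, g i x) ^ r ∂μ) ^ (1 / r) ≤ ∑ i ∈ s, (∫⁻ x, g i x ^ r ∂μ) ^ (1 / r) := by
    simpa [eLpNorm'] using
      eLpNorm'_sum_le (f := g) (s := s) (fun i _ => (hg i).aestronglyMeasurable) hr
  have hmono : Monotone fun (s : Finset ι) x => (∑ i ∈ s, g i x) ^ r := fun s t hst x =>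
    rpow_le_rpow (Finset.sum_le_sum_of_subset hst) hr0.le
  have hsup (x : α) : (∑' i, g i x) ^ r = ⨆ s : Finset ι, (∑ i ∈ s, g i x) ^ r := by
    rw [ENNReal.tsum_eq_iSup_sum]
    exact (orderIsoRpow r hr0).map_iSup _
  simp_rw [hsup]
  rw [lintegral_iSup_directed
    (fun s => (Finset.aemeasurable_fun_sum s fun i _ => hg i).pow_const r) hmono.directed_le,
    one_div, rpow_inv_le_iff hr0]
  refine iSup_le fun s => ?_
  rw [← rpow_inv_le_iff hr0, ← one_div]
  exact (hfin s).trans (ENNReal.sum_le_tsum s)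

theorem sqNorm_le_tsum {N : ℕ} {ι : Type*} [Countable ι] {μ : Measure (EucN N)} {q : ℝ}
    (hq : 2 ≤ q) {h : ι → EucN N → ℝ≥0∞} (hh : ∀ i, AEMeasurable (h i) μ) :
    sqNorm μ q h ≤ (∑' i, ((∫⁻ x, h i x ^ q ∂μ) ^ (1 / q)) ^ 2) ^ (1 / 2 : ℝ) := by
  have hq0 : 0 < q := by linarith
  have := lintegral_tsum_rpow_le (r := q / 2) (by linarith) fun i => (hh i).pow_const (2 : ℕ)
  have hpow (x : ℝ≥0∞) : (x ^ 2) ^ (q / 2) = x ^ q := by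
    rw [← ENNReal.rpow_natCast, ← ENNReal.rpow_mul]
    congr 1; push_cast; ring
  simp_rw [hpow] at this
  have h2 := rpow_le_rpow this (z := 1 / 2) (by norm_num)
  rw [← ENNReal.rpow_mul] at h2
  have e (x : ℝ≥0∞) : x ^ (1 / (q / 2)) = (x ^ (1 / q)) ^ 2 := by
    rw [← ENNReal.rpow_natCast, ← ENNReal.rpow_mul]
    congr 1; field_simp; norm_num
  simp_rw [e] at h2
  convert h2 using 1
  unfold sqNorm
  congr 1; field_simp

theorem tsum_lintegral_rpow_le {α ι : Type*} [MeasurableSpace α] [Countable ι] {μ : Measure α}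
    {θ : ℝ} (hθ : 0 < θ) (hθ1 : θ ≤ 1) {g : ι → α → ℝ≥0∞} (hg : ∀ i, AEMeasurable (g i) μ) :
    ∑' i, (∫⁻ x, g i x ^ θ ∂μ) ^ (1 / θ) ≤ (∫⁻ x, (∑' i, g i x) ^ θ ∂μ) ^ (1 / θ) := by
  set G : α → ℝ≥0∞ := fun x => ∑' i, g i x
  have hG : AEMeasurable G μ := AEMeasurable.tsum hg
  change _ ≤ (∫⁻ x, G x ^ θ ∂μ) ^ (1 / θ)
  set I := ∫⁻ x, G x ^ θ ∂μ with hI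
  by_cases hIt : I = ∞
  · rw [hIt, top_rpow_of_pos (by positivity)]; exact le_top
  have hfin : ∀ᵐ x ∂μ, G x ≠ ∞ := by
    filter_upwards [ae_lt_top' (hG.pow_const θ) hIt] with x hx h
    simp [h, hθ] at hx
  have hle (i : ι) (x : α) : g i x ≤ G x := ENNReal.le_tsum i
  have hterm (i : ι) : (∫⁻ x, g i x ^ θ ∂μ) ^ (1 / θ) ≤
      (∫⁻ x, g i x * G x ^ (θ - 1) ∂μ) * I ^ ((1 - θ) / θ) := by
    rw [one_div, rpow_inv_le_iff hθ, ENNReal.mul_rpow_of_nonneg _ _ hθ.le, ← ENNReal.rpow_mul,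
      div_mul_cancel₀ _ hθ.ne']
    refine le_trans (lintegral_mono_ae ?_) (lintegral_mul_norm_pow_le
      ((hg i).mul (hG.pow_const (θ - 1))) (hG.pow_const θ) hθ.le (sub_nonneg.2 hθ1) (by ring))
    filter_upwards [hfin] with x hx
    by_cases h0 : G x = 0
    · have : g i x = 0 := le_antisymm (h0 ▸ hle i x) zero_le
      simp [this, hθ]
    · simp only [Pi.mul_apply]
      rw [ENNReal.mul_rpow_of_nonneg _ _ hθ.le, ← ENNReal.rpow_mul, ← ENNReal.rpow_mul, mul_assoc,
        ← ENNReal.rpow_add _ _ h0 hx]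
      ring_nf
      simp
  calc ∑' i, (∫⁻ x, g i x ^ θ ∂μ) ^ (1 / θ)
      ≤ ∑' i, (∫⁻ x, g i x * G x ^ (θ - 1) ∂μ) * I ^ ((1 - θ) / θ) := ENNReal.tsum_le_tsum hterm
    _ = (∫⁻ x, G x * G x ^ (θ - 1) ∂μ) * I ^ ((1 - θ) / θ) := by
        have h := lintegral_tsum fun i => (hg i).mul (hG.pow_const (θ - 1))
        simp only [Pi.mul_apply, ENNReal.tsum_mul_right] at h
        rw [ENNReal.tsum_mul_right, ← h]
    _ ≤ I * I ^ ((1 - θ) / θ) := by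
        gcongr
        refine lintegral_mono_ae ?_
        filter_upwards [hfin] with x hx
        by_cases h0 : G x = 0
        · simp [h0]
        · conv_lhs => rw [← ENNReal.rpow_one (G x), ← ENNReal.rpow_mul, ← ENNReal.rpow_add _ _ h0 hx]
          ring_nf; rfl
    _ = I ^ (1 / θ) := by
        conv_lhs => rw [← ENNReal.rpow_one I, ← ENNReal.rpow_mul,
          ← ENNReal.rpow_add_of_nonneg _ _ (by norm_num)
            (mul_nonneg zero_le_one (div_nonneg (sub_nonneg.2 hθ1) hθ.le))]
        congr 1; field_simp; ring

theorem tsum_le_sqNorm {N : ℕ} {ι : Type*} [Countable ι] {μ : Measure (EucN N)} {p : ℝ}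
    (hp0 : 0 < p) (hp : p ≤ 2) {h : ι → EucN N → ℝ≥0∞} (hh : ∀ i, AEMeasurable (h i) μ) :
    (∑' i, ((∫⁻ x, h i x ^ p ∂μ) ^ (1 / p)) ^ 2) ^ (1 / 2 : ℝ) ≤ sqNorm μ p h := by
  have := tsum_lintegral_rpow_le (θ := p / 2) (by linarith) (by linarith)
    fun i => (hh i).pow_const (2 : ℕ)
  have hpow (x : ℝ≥0∞) : (x ^ 2) ^ (p / 2) = x ^ p := by
    rw [← ENNReal.rpow_natCast, ← ENNReal.rpow_mul]
    congr 1; push_cast; ring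
  simp_rw [hpow] at this
  have h2 := rpow_le_rpow this (z := 1 / 2) (by norm_num)
  rw [← ENNReal.rpow_mul _ _ (1 / 2)] at h2
  have e (x : ℝ≥0∞) : x ^ (1 / (p / 2)) = (x ^ (1 / p)) ^ 2 := by
    rw [← ENNReal.rpow_natCast, ← ENNReal.rpow_mul]
    congr 1; field_simp; norm_num
  simp_rw [e] at h2
  convert h2 using 1
  unfold sqNorm
  congr 1; field_simp

theorem dyCube_eq_pi (N : ℕ) (k : ℤ) (x : EucN N) :
    dyCube N k x = Set.pi univ fun i => Ico (x i) (x i + (2 : ℝ) ^ (-k)) := by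
  ext y; simp [dyCube, Set.mem_pi]

theorem volume_dyCube (N : ℕ) (k : ℤ) (x : EucN N) :
    volume (dyCube N k x) = ENNReal.ofReal (((2 : ℝ) ^ (-k)) ^ N) := by
  rw [dyCube_eq_pi, Real.volume_pi_Ico, ENNReal.ofReal_pow (by positivity)]
  simp

theorem measurableSet_dyCube (N : ℕ) (k : ℤ) (x : EucN N) : MeasurableSet (dyCube N k x) := by
  rw [dyCube_eq_pi]
  exact MeasurableSet.univ_pi fun i => measurableSet_Ico

theorem dyCube_interior_nonempty (N : ℕ) (k : ℤ) (x : EucN N) :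
    (interior (dyCube N k x)).Nonempty := by
  have h : (0 : ℝ) < (2 : ℝ) ^ (-k) := by positivity
  rw [dyCube_eq_pi, interior_pi_set finite_univ]
  refine ⟨fun i => x i + (2 : ℝ) ^ (-k) / 2, fun i _ => ?_⟩
  simp only [interior_Ico]
  constructor <;> linarith

namespace DyadicLattice

theorem exists_eq_dyCube {N : ℕ} (D : DyadicLattice N) {Q : Set (EucN N)} (hQ : Q ∈ D.cubes) :
    ∃ k x, Q = dyCube N k x := by
  obtain ⟨k, hk⟩ := mem_iUnion.1 hQ
  exact ⟨k, D.cube_form k Q hk⟩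

theorem countable_cubes {N : ℕ} (D : DyadicLattice N) : D.cubes.Countable := by
  refine countable_iUnion fun k => (D.pairwiseDisjoint k).countable_of_nonempty_interior ?_
  intro Q hQ
  obtain ⟨x, rfl⟩ := D.cube_form k Q hQ
  exact dyCube_interior_nonempty N k x

theorem measurableSet_of_mem_cubes {N : ℕ} (D : DyadicLattice N) {Q : Set (EucN N)}
    (hQ : Q ∈ D.cubes) : MeasurableSet Q := by
  obtain ⟨k, x, rfl⟩ := D.exists_eq_dyCube hQ
  exact measurableSet_dyCube N k x

end DyadicLattice

theorem measurable_indE {N : ℕ} {Q : Set (EucN N)} (hQ : MeasurableSet Q) :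
    Measurable (indE Q) :=
  measurable_const.indicator hQ

theorem lintegral_mul_indE_rpow {N : ℕ} {μ : Measure (EucN N)} {Q : Set (EucN N)}
    (hQ : MeasurableSet Q) (c : ℝ≥0∞) {q : ℝ} (hq : 0 < q) :
    (∫⁻ x, (c * indE Q x) ^ q ∂μ) ^ (1 / q) = c * μ Q ^ (1 / q) := by
  have h (x) : (c * indE Q x) ^ q = Q.indicator (fun _ => c ^ q) x := by
    by_cases hx : x ∈ Q <;> simp [indE, hx, hq]
  simp_rw [h]
  rw [lintegral_indicator_const hQ, ENNReal.mul_rpow_of_nonneg _ _ (by positivity),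
    ← ENNReal.rpow_mul, mul_one_div_cancel hq.ne', ENNReal.rpow_one]

theorem ofReal_abs_setIntegral_le {N : ℕ} {μ : Measure (EucN N)} {Q : Set (EucN N)}
    (hQ : MeasurableSet Q) {f : EucN N → ℝ} (hf : AEMeasurable f μ) {p : ℝ} (hp : 1 < p) :
    ENNReal.ofReal |∫ y in Q, f y ∂μ| ≤
      (∫⁻ x, ((‖f x‖₊ : ℝ≥0∞) * indE Q x) ^ p ∂μ) ^ (1 / p) * μ Q ^ (1 - 1 / p) := by
  have hp0 : 0 < p := by linarith
  have h1 : 1 / p ≤ 1 := by rw [div_le_one hp0]; exact hp.le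
  calc ENNReal.ofReal |∫ y in Q, f y ∂μ| = ‖∫ y in Q, f y ∂μ‖ₑ := by
        rw [← Real.norm_eq_abs, ofReal_norm]
    _ ≤ ∫⁻ y in Q, ‖f y‖ₑ ∂μ := enorm_integral_le_lintegral_enorm _
    _ = ∫⁻ y, (((‖f y‖₊ : ℝ≥0∞) * indE Q y) ^ p) ^ (1 / p) * indE Q y ^ (1 - 1 / p) ∂μ := by
        rw [← lintegral_indicator hQ]
        refine lintegral_congr fun y => ?_
        rw [← ENNReal.rpow_mul, mul_one_div_cancel hp0.ne', ENNReal.rpow_one]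
        by_cases hy : y ∈ Q <;> simp [indE, hy, enorm]
    _ ≤ (∫⁻ x, ((‖f x‖₊ : ℝ≥0∞) * indE Q x) ^ p ∂μ) ^ (1 / p) *
          (∫⁻ x, indE Q x ∂μ) ^ (1 - 1 / p) :=
        lintegral_mul_norm_pow_le
          ((hf.enorm.mul (measurable_indE hQ).aemeasurable).pow_const p)
          (measurable_indE hQ).aemeasurable (by positivity) (sub_nonneg.2 h1) (by ring)
    _ = _ := by
        congr 2
        exact lintegral_indicator_one hQ

theorem steinC_le_simpleA {N : ℕ} (D : DyadicLattice N) (σ w : Measure (EucN N)) {p q : ℝ}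
    (hp1 : 1 < p) (hp : p ≤ 2) (hq : 2 ≤ q) [IsLocallyFiniteMeasure σ] :
    steinC D σ w p q ≤ simpleA D σ w p q := by
  refine sInf_le fun f hf => ?_
  have hp0 : 0 < p := by linarith
  have hq0 : 0 < q := by linarith
  have : Countable D.cubes := D.countable_cubes.to_subtype
  have hmeas (Q : D.cubes) : MeasurableSet (Q : Set (EucN N)) :=
    D.measurableSet_of_mem_cubes Q.2
  have hfm (Q : D.cubes) : AEMeasurable (f Q) σ :=
    (hf Q Q.2).aestronglyMeasurable.aemeasurable
  refine (sqNorm_le_tsum hq fun Q =>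
    ((measurable_indE (hmeas Q)).const_mul _).aemeasurable).trans ?_
  refine le_trans ?_ (mul_le_mul_right (tsum_le_sqNorm hp0 hp fun Q =>
    (hfm Q).enorm.mul (measurable_indE (hmeas Q)).aemeasurable) _)
  set A := simpleA D σ w p q
  have hA : A = (A ^ 2) ^ (1 / 2 : ℝ) := by
    rw [← ENNReal.rpow_natCast, ← ENNReal.rpow_mul]; simp
  rw [hA, ← ENNReal.mul_rpow_of_nonneg _ _ (by norm_num), ← ENNReal.tsum_mul_left]
  refine rpow_le_rpow (ENNReal.tsum_le_tsum fun Q => ?_) (by norm_num)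
  rw [← mul_pow]
  gcongr
  rw [lintegral_mul_indE_rpow (hmeas Q) _ hq0]
  set F := (∫⁻ x, ((‖f Q x‖₊ : ℝ≥0∞) * indE Q x) ^ p ∂σ) ^ (1 / p)
  calc _ ≤ F * σ Q ^ (1 - 1 / p) / volume (Q : Set (EucN N)) * w Q ^ (1 / q) := by
        gcongr
        exact ofReal_abs_setIntegral_le (hmeas Q) (hfm Q) hp1
    _ = σ Q ^ (1 - 1 / p) * w Q ^ (1 / q) / volume (Q : Set (EucN N)) * F := by
        simp only [div_eq_mul_inv]; ring
    _ ≤ A * F := by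
        gcongr
        exact le_iSup₂_of_le (Q : Set (EucN N)) Q.2 le_rfl

theorem mem_dyCube_int_mul_iff {N : ℕ} {k : ℤ} {m : Fin N → ℤ} {y : EucN N} :
    y ∈ dyCube N k (fun i => m i * (2 : ℝ) ^ (-k)) ↔ ∀ i, ⌊y i * (2 : ℝ) ^ k⌋ = m i := by
  have h : (0 : ℝ) < (2 : ℝ) ^ k := by positivity
  refine forall_congr' fun i => ?_
  beta_reduce
  rw [Int.floor_eq_iff, zpow_neg, ← div_eq_mul_inv, div_le_iff₀ h,
    show (m i : ℝ) / 2 ^ k + (2 ^ k)⁻¹ = (m i + 1) / 2 ^ k by ring, lt_div_iff₀ h]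

/-- The standard dyadic lattice, of cubes `2^{-k} (m + [0,1)^N)` with `m ∈ ℤ^N`. -/
def stdLattice (N : ℕ) : DyadicLattice N where
  gen k := range fun m : Fin N → ℤ => dyCube N k (fun i => m i * (2 : ℝ) ^ (-k))
  cube_form := by
    rintro k _ ⟨m, rfl⟩
    exact ⟨_, rfl⟩
  covers k y := ⟨_, ⟨fun i => ⌊y i * (2 : ℝ) ^ k⌋, rfl⟩, mem_dyCube_int_mul_iff.2 fun _ => rfl⟩
  pairwiseDisjoint := by
    rintro k _ ⟨m, rfl⟩ _ ⟨m', rfl⟩ hne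
    refine Set.disjoint_left.2 fun y hy hy' => hne ?_
    have : m = m' := funext fun i =>
      (mem_dyCube_int_mul_iff.1 hy i).symm.trans (mem_dyCube_int_mul_iff.1 hy' i)
    rw [this]
  nested := by
    rintro k _ ⟨m, rfl⟩
    refine ⟨_, ⟨fun i => m i / 2, rfl⟩, fun y hy => mem_dyCube_int_mul_iff.2 fun i => ?_⟩
    rw [← mem_dyCube_int_mul_iff.1 hy i, zpow_add_one₀ two_ne_zero,
      show y i * (2 : ℝ) ^ k = y i * (2 ^ k * 2) / (2 : ℕ) by push_cast; ring,
      Int.floor_div_natCast]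
    rfl

/-- The standard dyadic cube `[0, 2^{-k})^N` cornered at the origin. -/
def cornerCube (N : ℕ) (k : ℤ) : Set (EucN N) := dyCube N k 0

theorem cornerCube_mem (N : ℕ) (k : ℤ) : cornerCube N k ∈ (stdLattice N).cubes := by
  refine mem_iUnion.2 ⟨k, 0, ?_⟩
  simp [cornerCube, Pi.zero_def]

theorem eq_cornerCube {N : ℕ} {Q : Set (EucN N)} (hQ : Q ∈ (stdLattice N).cubes) (h0 : 0 ∈ Q) :
    ∃ k, Q = cornerCube N k := by
  obtain ⟨k, m, rfl⟩ := mem_iUnion.1 hQ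
  have hm : m = 0 := funext fun i => by
    simpa using (mem_dyCube_int_mul_iff.1 h0 i).symm
  exact ⟨k, by simp [cornerCube, hm, Pi.zero_def]⟩

theorem zero_mem_cornerCube (N : ℕ) (k : ℤ) : 0 ∈ cornerCube N k := fun i => by
  have : (0 : ℝ) < 2 ^ (-k) := by positivity
  simpa using this

theorem measurableSet_cornerCube (N : ℕ) (k : ℤ) : MeasurableSet (cornerCube N k) :=
  measurableSet_dyCube N k 0

/-- The volume of a dyadic cube of side `2^{-k}`. -/
def cubeVol (N : ℕ) (k : ℤ) : ℝ := ((2 : ℝ) ^ (-k)) ^ N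

theorem cubeVol_pos (N : ℕ) (k : ℤ) : 0 < cubeVol N k := by unfold cubeVol; positivity

theorem volume_cornerCube (N : ℕ) (k : ℤ) :
    volume (cornerCube N k) = ENNReal.ofReal (cubeVol N k) :=
  volume_dyCube N k 0

theorem cubeVol_add (N : ℕ) (k l : ℤ) : cubeVol N (k + l) = cubeVol N k * cubeVol N l := by
  unfold cubeVol
  rw [← mul_pow, ← zpow_add₀ two_ne_zero]
  congr 2; ring

theorem one_le_cubeVol (N : ℕ) {k : ℤ} (hk : k ≤ 0) : 1 ≤ cubeVol N k :=
  one_le_pow₀ (one_le_zpow₀ one_le_two (by omega))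

theorem summable_cubeVol_rpow {N : ℕ} (hN : 1 ≤ N) {s : ℝ} (hs : 0 < s) :
    Summable fun j : ℕ => cubeVol N j ^ s := by
  have h (j : ℕ) : cubeVol N j ^ s = (cubeVol N 1 ^ s) ^ j := by
    rw [← Real.rpow_natCast, ← Real.rpow_mul (cubeVol_pos N 1).le, mul_comm,
      Real.rpow_mul (cubeVol_pos N 1).le, Real.rpow_natCast]
    congr 1
    unfold cubeVol
    rw [← pow_mul, mul_comm, pow_mul]
    simp
  simp_rw [h]
  refine summable_geometric_of_lt_one (Real.rpow_nonneg (cubeVol_pos N 1).le s)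
    (Real.rpow_lt_one (cubeVol_pos N 1).le ?_ hs)
  unfold cubeVol
  exact pow_lt_one₀ (by positivity) (by norm_num) (by omega)

/-- A point of `[0, 2^{-j})^N` outside of `[0, 2^{-j-1})^N`. -/
def cornerPoint (N j : ℕ) : EucN N := fun _ => (2 : ℝ) ^ (-((j : ℤ) + 1))

theorem cornerPoint_mem_iff {N : ℕ} (hN : 1 ≤ N) {j : ℕ} {k : ℤ} :
    cornerPoint N j ∈ cornerCube N k ↔ k ≤ j := by
  have : Nonempty (Fin N) := ⟨⟨0, hN⟩⟩
  simp only [cornerCube, dyCube, cornerPoint, mem_ofPred_eq, Pi.zero_apply, zero_add,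
    forall_const, zpow_lt_zpow_iff_right₀ (one_lt_two (α := ℝ))]
  constructor
  · rintro ⟨-, h⟩; omega
  · intro h; exact ⟨by positivity, by omega⟩

theorem cornerPoint_injective {N : ℕ} (hN : 1 ≤ N) : Function.Injective (cornerPoint N) := by
  intro i j h
  have h1 := (cornerPoint_mem_iff hN (j := i) (k := i)).2 le_rfl
  have h2 := (cornerPoint_mem_iff hN (j := j) (k := j)).2 le_rfl
  rw [h, cornerPoint_mem_iff hN] at h1
  rw [← h, cornerPoint_mem_iff hN] at h2
  omega

theorem cornerCube_injective {N : ℕ} (hN : 1 ≤ N) :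
    Function.Injective fun n : ℕ => cornerCube N n := by
  intro i j h
  have h1 := (cornerPoint_mem_iff hN (j := i) (k := i)).2 le_rfl
  have h2 := (cornerPoint_mem_iff hN (j := j) (k := j)).2 le_rfl
  rw [show cornerCube N i = cornerCube N j from h, cornerPoint_mem_iff hN] at h1
  rw [show cornerCube N j = cornerCube N i from h.symm, cornerPoint_mem_iff hN] at h2
  omega

/-- The measure with an atom of mass `|Q_j|^s` at the `j`-th corner point, where
`Q_j = [0, 2^{-j})^N`. -/
def cornerMeasure (N : ℕ) (s : ℝ) : Measure (EucN N) :=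
  Measure.sum fun j : ℕ => ENNReal.ofReal (cubeVol N j ^ s) • Measure.dirac (cornerPoint N j)

theorem cornerMeasure_apply (N : ℕ) (s : ℝ) {A : Set (EucN N)} (hA : MeasurableSet A) :
    cornerMeasure N s A =
      ∑' j : ℕ, ENNReal.ofReal (cubeVol N j ^ s) * A.indicator 1 (cornerPoint N j) := by
  rw [cornerMeasure, Measure.sum_apply _ hA]
  simp [Measure.dirac_apply' _ hA]

theorem lintegral_cornerMeasure (N : ℕ) (s : ℝ) (f : EucN N → ℝ≥0∞) :
    ∫⁻ x, f x ∂cornerMeasure N s =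
      ∑' j : ℕ, ENNReal.ofReal (cubeVol N j ^ s) * f (cornerPoint N j) := by
  rw [cornerMeasure, lintegral_sum_measure]
  simp

theorem cornerMeasure_univ (N : ℕ) (s : ℝ) :
    cornerMeasure N s univ = ∑' j : ℕ, ENNReal.ofReal (cubeVol N j ^ s) := by
  simp [cornerMeasure_apply]

theorem isFiniteMeasure_cornerMeasure {N : ℕ} (hN : 1 ≤ N) {s : ℝ} (hs : 0 < s) :
    IsFiniteMeasure (cornerMeasure N s) := by
  refine ⟨?_⟩
  rw [cornerMeasure_univ]
  exact (summable_cubeVol_rpow hN hs).tsum_ofReal_lt_top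

theorem cornerMeasure_singleton {N : ℕ} (hN : 1 ≤ N) (s : ℝ) (n : ℕ) :
    cornerMeasure N s {cornerPoint N n} = ENNReal.ofReal (cubeVol N n ^ s) := by
  rw [cornerMeasure_apply _ _ (measurableSet_singleton _), tsum_eq_single n]
  · simp
  · intro j hj
    simp [(cornerPoint_injective hN).ne hj]

theorem cornerMeasure_cornerCube_le {N : ℕ} (hN : 1 ≤ N) {s : ℝ} (hs : 0 < s) (k : ℤ) :
    cornerMeasure N s (cornerCube N k) ≤
      cornerMeasure N s univ * ENNReal.ofReal (cubeVol N k ^ s) := by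
  rcases le_total k 0 with hk | hk
  · refine (measure_mono (subset_univ _)).trans (le_mul_of_one_le_right' ?_)
    rw [ENNReal.one_le_ofReal]
    exact Real.one_le_rpow (one_le_cubeVol N hk) hs.le
  · lift k to ℕ using hk
    rw [cornerMeasure_apply _ _ (measurableSet_cornerCube N k), cornerMeasure_univ,
      ← (add_left_injective k).tsum_eq, ← ENNReal.tsum_mul_right]
    · refine ENNReal.tsum_le_tsum fun i => ?_
      rw [← ENNReal.ofReal_mul (Real.rpow_nonneg (cubeVol_pos N _).le _),
        ← Real.mul_rpow (cubeVol_pos N _).le (cubeVol_pos N _).le, ← cubeVol_add, Nat.cast_add]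
      exact mul_le_of_le_one_right' (indicator_le_self' (by simp) _)
    · intro j hj
      have : cornerPoint N j ∈ cornerCube N k := by
        by_contra h
        exact hj (by simp [h])
      rw [cornerPoint_mem_iff hN] at this
      exact ⟨j - k, by simp; omega⟩

theorem cornerMeasure_rpow_div_volume_le {N : ℕ} (hN : 1 ≤ N) {s : ℝ} (hs : 0 < s)
    {Q : Set (EucN N)} (hQ : Q ∈ (stdLattice N).cubes) (h0 : 0 ∈ Q) :
    cornerMeasure N s Q ^ (1 / s) / volume Q ≤ cornerMeasure N s univ ^ (1 / s) := by
  obtain ⟨k, rfl⟩ := eq_cornerCube hQ h0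
  have hv := cubeVol_pos N k
  rw [volume_cornerCube]
  refine ENNReal.div_le_of_le_mul ((ENNReal.rpow_le_rpow
    (cornerMeasure_cornerCube_le hN hs k) (by positivity)).trans_eq ?_)
  rw [ENNReal.mul_rpow_of_nonneg _ _ (by positivity), ENNReal.ofReal_rpow_of_pos
    (Real.rpow_pos_of_pos hv s), ← Real.rpow_mul hv.le, mul_one_div_cancel hs.ne', Real.rpow_one]

theorem steinC_eq_top {N : ℕ} {D : DyadicLattice N} {σ w : Measure (EucN N)} {p q : ℝ}
    (f : Set (EucN N) → EucN N → ℝ) (hf : ∀ Q ∈ D.cubes, LocallyIntegrable (f Q) σ)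
    (hl : sqNorm w q (fun Q : D.cubes => fun x =>
      ENNReal.ofReal |∫ y in (Q : Set (EucN N)), f (Q : Set (EucN N)) y ∂σ|
        / volume (Q : Set (EucN N)) * indE (Q : Set (EucN N)) x) = ∞)
    (hr : sqNorm σ p (fun Q : D.cubes => fun x =>
      (‖f (Q : Set (EucN N)) x‖₊ : ℝ≥0∞) * indE (Q : Set (EucN N)) x) ≠ ∞) :
    steinC D σ w p q = ∞ := by
  refine sInf_eq_top.2 fun C hC => ?_
  have h := hC f hf
  rw [hl, top_le_iff] at h
  by_contra hCt
  exact ENNReal.mul_ne_top hCt hr h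

/-- The family of functions equal to `F n` on the cube `[0, 2^{-n})^N` for `n : ℕ` and vanishing
for the other cubes. -/
def cornerFamily {N : ℕ} (F : ℕ → EucN N → ℝ) : Set (EucN N) → EucN N → ℝ :=
  Function.extend (fun n : ℕ => cornerCube N n) F 0

theorem cornerFamily_cornerCube {N : ℕ} (hN : 1 ≤ N) (F : ℕ → EucN N → ℝ) (n : ℕ) :
    cornerFamily F (cornerCube N n) = F n :=
  (cornerCube_injective hN).extend_apply F 0 n

theorem locallyIntegrable_cornerFamily {N : ℕ} (hN : 1 ≤ N) {F : ℕ → EucN N → ℝ}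
    {σ : Measure (EucN N)} (hF : ∀ n, Integrable (F n) σ) (Q : Set (EucN N)) :
    LocallyIntegrable (cornerFamily F Q) σ := by
  by_cases h : ∃ n : ℕ, cornerCube N n = Q
  · obtain ⟨n, rfl⟩ := h
    rw [cornerFamily_cornerCube hN]
    exact (hF n).locallyIntegrable
  · rw [cornerFamily, Function.extend_apply' _ _ _ h]
    exact locallyIntegrable_zero

theorem sqNorm_cornerFamily {N : ℕ} (hN : 1 ≤ N) (F : ℕ → EucN N → ℝ) (σ : Measure (EucN N))
    (p : ℝ) :
    sqNorm σ p (fun Q : (stdLattice N).cubes => fun x =>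
      (‖cornerFamily F (Q : Set (EucN N)) x‖₊ : ℝ≥0∞) * indE (Q : Set (EucN N)) x) =
    sqNorm σ p (fun (n : ℕ) x => (‖F n x‖₊ : ℝ≥0∞) * indE (cornerCube N n) x) := by
  unfold sqNorm
  congr 1
  refine lintegral_congr fun x => ?_
  congr 1
  have hinj : Function.Injective fun n : ℕ =>
      (⟨cornerCube N n, cornerCube_mem N n⟩ : (stdLattice N).cubes) := fun i j h =>
    cornerCube_injective hN (Subtype.ext_iff.1 h)
  rw [← hinj.tsum_eq]
  · simp only [cornerFamily_cornerCube hN]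
  · intro Q hQ
    by_contra h
    refine hQ ?_
    have h' : ¬ ∃ n : ℕ, cornerCube N n = Q := fun ⟨n, hn⟩ => h ⟨n, Subtype.ext hn⟩
    simp [cornerFamily, Function.extend_apply' _ _ _ h']

theorem le_sqNorm_average_cornerFamily {N : ℕ} (hN : 1 ≤ N) (F : ℕ → EucN N → ℝ)
    (σ w : Measure (EucN N)) {q : ℝ} (hq : 0 < q) :
    sqNorm w q (fun (n : ℕ) x => ENNReal.ofReal |∫ y in cornerCube N n, F n y ∂σ| /
        ENNReal.ofReal (cubeVol N n) * indE (cornerCube N n) x) ≤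
      sqNorm w q (fun Q : (stdLattice N).cubes => fun x =>
        ENNReal.ofReal |∫ y in (Q : Set (EucN N)), cornerFamily F (Q : Set (EucN N)) y ∂σ|
          / volume (Q : Set (EucN N)) * indE (Q : Set (EucN N)) x) := by
  unfold sqNorm
  gcongr with x
  have hinj : Function.Injective fun n : ℕ =>
      (⟨cornerCube N n, cornerCube_mem N n⟩ : (stdLattice N).cubes) := fun i j h =>
    cornerCube_injective hN (Subtype.ext_iff.1 h)
  refine le_trans (le_of_eq ?_) (ENNReal.tsum_comp_le_tsum_of_injective hinj _)
  simp only [cornerFamily_cornerCube hN, volume_cornerCube]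

theorem tsum_ofReal_add_one_rpow_ne_top_iff (s : ℝ) :
    ∑' n : ℕ, ENNReal.ofReal (((n : ℝ) + 1) ^ (-s)) ≠ ∞ ↔ 1 < s := by
  rw [← Real.summable_one_div_nat_add_rpow 1 s]
  have h (n : ℕ) : 1 / |(n : ℝ) + 1| ^ s = ((n : ℝ) + 1) ^ (-s) := by
    rw [abs_of_pos (by positivity), Real.rpow_neg (by positivity), one_div]
  simp_rw [h]
  refine ⟨fun hs => ?_, fun hs => hs.tsum_ofReal_ne_top⟩
  have := ENNReal.summable_toReal hs
  refine this.congr fun n => ENNReal.toReal_ofReal (by positivity)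

theorem exists_simpleA_ne_top_steinC_eq_top_of_two_lt {N : ℕ} (hN : 1 ≤ N) {p q : ℝ} (hp : 2 < p)
    (hq : 1 < q) : ∃ σ w : Measure (EucN N), IsLocallyFiniteMeasure σ ∧ IsLocallyFiniteMeasure w ∧
      simpleA (stdLattice N) σ w p q ≠ ∞ ∧ steinC (stdLattice N) σ w p q = ∞ := by
  have hp0 : 0 < p := by linarith
  have hq0 : 0 < q := by linarith
  set s : ℝ := p / (p - 1) with hs
  have hp1 : 0 < p - 1 := by linarith
  have hs0 : 0 < s := by positivity
  have hsi : 1 - 1 / p = 1 / s := by rw [hs]; field_simp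
  have hfin := isFiniteMeasure_cornerMeasure hN hs0
  refine ⟨cornerMeasure N s, Measure.dirac 0, inferInstance, inferInstance, ?_, ?_⟩
  · refine ne_top_of_le_ne_top (b := cornerMeasure N s univ ^ (1 / s))
      (ENNReal.rpow_ne_top_of_nonneg (by positivity) (measure_ne_top _ _)) (iSup₂_le fun Q hQ => ?_)
    by_cases h0 : (0 : EucN N) ∈ Q
    · rw [hsi]
      simpa [h0] using cornerMeasure_rpow_div_volume_le hN hs0 hQ h0
    · simp [Measure.dirac_apply, h0, hq0]
  set b : ℕ → ℝ := fun n => ((n : ℝ) + 1) ^ (-(1 / 2) : ℝ) with hb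
  have hb0 (n : ℕ) : 0 < b n := by positivity
  set c : ℕ → ℝ := fun n => b n * cubeVol N n ^ (1 - s) with hc
  have hc0 (n : ℕ) : 0 < c n := mul_pos (hb0 n) (Real.rpow_pos_of_pos (cubeVol_pos N n) _)
  set F : ℕ → EucN N → ℝ := fun n => ({cornerPoint N n} : Set (EucN N)).indicator fun _ => c n
    with hF
  have hint (n : ℕ) : ∫ y in cornerCube N n, F n y ∂cornerMeasure N s = b n * cubeVol N n := by
    have hv := cubeVol_pos N n
    have hsub : {cornerPoint N n} ⊆ cornerCube N n :=
      singleton_subset_iff.2 ((cornerPoint_mem_iff hN).2 le_rfl)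
    simp only [F]
    rw [integral_indicator_const _ (measurableSet_singleton _),
      measureReal_restrict_apply (measurableSet_singleton _), inter_eq_left.2 hsub,
      Measure.real, cornerMeasure_singleton hN, ENNReal.toReal_ofReal (by positivity), smul_eq_mul,
      mul_left_comm, ← Real.rpow_add hv]
    simp
  refine steinC_eq_top (cornerFamily F) (fun Q _ => locallyIntegrable_cornerFamily hN
    (fun n => (integrable_const _).indicator (measurableSet_singleton _)) Q) ?_ ?_
  · refine top_le_iff.1 (le_trans (top_le_iff.2 ?_)
      (le_sqNorm_average_cornerFamily hN F _ _ hq0))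
    have hterm (n : ℕ) : (ENNReal.ofReal |b n * cubeVol N n| / ENNReal.ofReal (cubeVol N n) *
        indE (cornerCube N n) 0) ^ 2 = ENNReal.ofReal (((n : ℝ) + 1) ^ (-1 : ℝ)) := by
      have hv := cubeVol_pos N n
      rw [abs_of_pos (mul_pos (hb0 n) hv), ← ENNReal.ofReal_div_of_pos hv,
        mul_div_cancel_right₀ _ hv.ne', indE, indicator_of_mem (zero_mem_cornerCube N n),
        Pi.one_apply, mul_one, ← ENNReal.ofReal_pow (hb0 n).le, hb, ← Real.rpow_mul_natCast
        (by positivity)]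
      norm_num
    simp only [sqNorm, hint, lintegral_dirac, hterm]
    have := (tsum_ofReal_add_one_rpow_ne_top_iff 1).not.2 (lt_irrefl _)
    rw [not_not.1 this, top_rpow_of_pos (by positivity), top_rpow_of_pos (by positivity)]
  · rw [sqNorm_cornerFamily hN, sqNorm, lintegral_cornerMeasure]
    refine ENNReal.rpow_ne_top_of_nonneg (by positivity) ?_
    have hterm (j : ℕ) : ENNReal.ofReal (cubeVol N j ^ s) * (∑' n : ℕ,
        ((‖F n (cornerPoint N j)‖₊ : ℝ≥0∞) * indE (cornerCube N n) (cornerPoint N j)) ^ 2)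
          ^ (p / 2) = ENNReal.ofReal (((j : ℝ) + 1) ^ (-(p / 2))) := by
      have hv := cubeVol_pos N j
      rw [tsum_eq_single j]
      · have hm : cornerPoint N j ∈ cornerCube N j := (cornerPoint_mem_iff hN).2 le_rfl
        rw [indE, indicator_of_mem hm, Pi.one_apply, mul_one, ← ENNReal.rpow_natCast,
          ← ENNReal.rpow_mul, hF]
        simp only [indicator_of_mem (mem_singleton _)]
        rw [← enorm_eq_nnnorm, Real.enorm_eq_ofReal (hc0 j).le, ENNReal.ofReal_rpow_of_pos (hc0 j),
          ← ENNReal.ofReal_mul (by positivity), hc, hb]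
        simp only
        rw [Real.mul_rpow (by positivity) (by positivity), mul_left_comm, ← Real.rpow_mul hv.le,
          ← Real.rpow_add hv, ← Real.rpow_mul (by positivity)]
        have e : s + (1 - s) * (((2 : ℕ) : ℝ) * (p / 2)) = 0 := by
          rw [hs]; field_simp; push_cast; ring
        rw [e, Real.rpow_zero, mul_one]
        congr 2
        push_cast; ring
      · intro n hn
        simp [F, ((cornerPoint_injective hN).ne hn).symm]
    simp_rw [hterm]
    rw [tsum_ofReal_add_one_rpow_ne_top_iff]
    linarith

theorem exists_simpleA_ne_top_steinC_eq_top_of_lt_two {N : ℕ} (hN : 1 ≤ N) {p q : ℝ} (hp : 1 < p)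
    (hq : 1 < q) (hq2 : q < 2) : ∃ σ w : Measure (EucN N),
      IsLocallyFiniteMeasure σ ∧ IsLocallyFiniteMeasure w ∧
      simpleA (stdLattice N) σ w p q ≠ ∞ ∧ steinC (stdLattice N) σ w p q = ∞ := by
  have hp0 : 0 < p := by linarith
  have hq0 : 0 < q := by linarith
  have hfin := isFiniteMeasure_cornerMeasure hN hq0
  have hpi : 0 < 1 - 1 / p := by rw [sub_pos, div_lt_one hp0]; exact hp
  refine ⟨Measure.dirac 0, cornerMeasure N q, inferInstance, inferInstance, ?_, ?_⟩
  · refine ne_top_of_le_ne_top (b := cornerMeasure N q univ ^ (1 / q))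
      (ENNReal.rpow_ne_top_of_nonneg (by positivity) (measure_ne_top _ _)) (iSup₂_le fun Q hQ => ?_)
    by_cases h0 : (0 : EucN N) ∈ Q
    · simpa [h0] using cornerMeasure_rpow_div_volume_le hN hq0 hQ h0
    · rw [Measure.dirac_apply, indicator_of_notMem h0, ENNReal.zero_rpow_of_pos hpi]
      simp
  set b : ℕ → ℝ := fun n => ((n : ℝ) + 1) ^ (-(1 / q)) with hb
  have hb0 (n : ℕ) : 0 < b n := by positivity
  have hint (n : ℕ) : ∫ _ in cornerCube N n, b n ∂Measure.dirac (0 : EucN N) = b n := by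
    simp [Measure.real, zero_mem_cornerCube]
  refine steinC_eq_top (cornerFamily fun n _ => b n) (fun Q _ => locallyIntegrable_cornerFamily hN
    (fun n => integrable_const _) Q) ?_ ?_
  · refine top_le_iff.1 (le_trans (top_le_iff.2 ?_)
      (le_sqNorm_average_cornerFamily hN _ _ _ hq0))
    simp only [hint]
    have hterm (j : ℕ) : ENNReal.ofReal (((j : ℝ) + 1) ^ (-1 : ℝ)) ≤
        ENNReal.ofReal (cubeVol N j ^ q) * (∑' n : ℕ, (ENNReal.ofReal |b n| /
          ENNReal.ofReal (cubeVol N n) * indE (cornerCube N n) (cornerPoint N j)) ^ 2)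
            ^ (q / 2) := by
      have hv := cubeVol_pos N j
      refine le_trans (le_of_eq ?_) (mul_le_mul_right
        (ENNReal.rpow_le_rpow (ENNReal.le_tsum j) (by positivity)) _)
      have hm : cornerPoint N j ∈ cornerCube N j := (cornerPoint_mem_iff hN).2 le_rfl
      have hbv : 0 < b j / cubeVol N j := div_pos (hb0 j) hv
      rw [indE, indicator_of_mem hm, Pi.one_apply, mul_one, abs_of_pos (hb0 j),
        ← ENNReal.ofReal_div_of_pos hv, ← ENNReal.rpow_natCast, ← ENNReal.rpow_mul,
        ENNReal.ofReal_rpow_of_pos hbv, ← ENNReal.ofReal_mul (by positivity),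
        show ((2 : ℕ) : ℝ) * (q / 2) = q by push_cast; ring,
        ← Real.mul_rpow hv.le hbv.le, mul_div_cancel₀ _ hv.ne', hb]
      simp only
      rw [← Real.rpow_mul (by positivity)]
      congr 2
      field_simp
    rw [sqNorm, lintegral_cornerMeasure]
    have := ENNReal.tsum_le_tsum hterm
    rw [not_not.1 ((tsum_ofReal_add_one_rpow_ne_top_iff 1).not.2 (lt_irrefl _)), top_le_iff] at this
    rw [this, top_rpow_of_pos (by positivity)]
  · rw [sqNorm_cornerFamily hN, sqNorm, lintegral_dirac]
    refine ENNReal.rpow_ne_top_of_nonneg (by positivity)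
      (ENNReal.rpow_ne_top_of_nonneg (by positivity) ?_)
    have hterm (n : ℕ) : ((‖b n‖₊ : ℝ≥0∞) * indE (cornerCube N n) 0) ^ 2 =
        ENNReal.ofReal (((n : ℝ) + 1) ^ (-(2 / q))) := by
      rw [indE, indicator_of_mem (zero_mem_cornerCube N n), Pi.one_apply, mul_one,
        ← enorm_eq_nnnorm, Real.enorm_eq_ofReal (hb0 n).le, ← ENNReal.ofReal_pow (hb0 n).le, hb,
        ← Real.rpow_mul_natCast (by positivity)]
      congr 2
      push_cast; ring
    simp_rw [hterm]
    rw [tsum_ofReal_add_one_rpow_ne_top_iff, one_lt_div hq0]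
    exact hq2

/-- The simple `A_{p,q}`-condition is sufficient for the two-weight Stein
inequality (for all Radon measures `σ`, `w` on `ℝ^N`) if and only if `1 < p ≤ 2 ≤ q < ∞`. -/
theorem simple_Apq_sufficient_for_Stein_iff (N : ℕ) (hN : 1 ≤ N) (p q : ℝ)
    (hp : 1 < p) (hq : 1 < q) :
    (∀ (D : DyadicLattice N) (σ w : Measure (EucN N)),
        IsLocallyFiniteMeasure σ → IsLocallyFiniteMeasure w →
        simpleA D σ w p q ≠ ∞ → steinC D σ w p q ≠ ∞) ↔
      (p ≤ 2 ∧ 2 ≤ q) := by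
  constructor
  · intro h
    constructor
    · by_contra! hp2
      obtain ⟨σ, w, hσ, hw, hA, hS⟩ := exists_simpleA_ne_top_steinC_eq_top_of_two_lt hN hp2 hq
      exact h _ σ w hσ hw hA hS
    · by_contra! hq2
      obtain ⟨σ, w, hσ, hw, hA, hS⟩ := exists_simpleA_ne_top_steinC_eq_top_of_lt_two hN hp hq hq2
      exact h _ σ w hσ hw hA hS
  · rintro ⟨hp2, hq2⟩ D σ w _ _ hA
    exact ne_top_of_le_ne_top hA (steinC_le_simpleA D σ w hp hp2 hq2)

end
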